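/- arXiv:0809.3199 — 2 statements merged into one kernel-verified Lean document; each statement's English description precedes it below -/
import Mathlib

section
/- Let d ≥ 1, ε > 0, λ ∈ ℝ, and let the components of A : ℝ^d → ℝ^d be of class C^∞_pol. Let K ∈ S(ℝ^d × ℝ^d) and let T be the integral operator (Tφ)(x) := ∫_{ℝ^d} K(x,y) φ(y) dy. Define f(x,ξ) := ∫_{ℝ^d} e^{-i y·ξ} e^{-iλ Γ^A_ε([x/ε − y/2, x/ε + y/2])} K(x/ε + y/2, x/ε − y/2) dy. Then f ∈ S(ℝ^{2d}) and Op^A_{ε,λ}(f) = T, i.e. for every φ ∈ S(ℝ^d) and every x ∈ ℝ^d, (Op^A_{ε,λ}(f)φ)(x) = ∫_{ℝ^d} K(x,y) φ(y) dy. In other words, the magnetic Wigner transform of the operator kernel inverts magnetic Weyl quantization on operators with Schwartz kernels. -/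
noncomputable section
open MeasureTheory Complex

/-- `ℝ^d` -/
abbrev Vd (d : ℕ) := Fin d → ℝ

/-- Euclidean dot product. -/
def dotR {d : ℕ} (x y : Vd d) : ℝ := ∑ l, x l * y l

/-- Circulation `Γ^A([u,v]) = Σ_l (v_l - u_l) ∫_0^1 A_l(u + s(v-u)) ds`. -/
def circA {d : ℕ} (A : Vd d → Vd d) (u v : Vd d) : ℝ :=
  ∑ l, (v l - u l) * ∫ s in (0:ℝ)..1, A (u + s • (v - u)) l

/-- The `ε`-scaled circulation `Γ^A_ε([u,v]) := (1/ε) Γ^A([εu,εv])`. -/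
def circAe {d : ℕ} (ε : ℝ) (A : Vd d → Vd d) (u v : Vd d) : ℝ :=
  ε⁻¹ * circA A (ε • u) (ε • v)

/-- A function is of class `C^∞_pol` if it is smooth and it together with all its
derivatives is polynomially bounded. -/
def CPol {E F : Type*} [NormedAddCommGroup E] [NormedSpace ℝ E]
    [NormedAddCommGroup F] [NormedSpace ℝ F] (f : E → F) : Prop :=
  ContDiff ℝ (⊤ : ℕ∞) f ∧
    ∀ n : ℕ, ∃ (C : ℝ) (k : ℕ), ∀ x, ‖iteratedFDeriv ℝ n f x‖ ≤ C * (1 + ‖x‖) ^ k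

/-- Magnetic Weyl quantization in the adiabatic scaling:
`(Op^A_{ε,λ}(f)φ)(x) = (2π)^{-d} ∫∫ e^{-i(y-x)·η} e^{-iλΓ^A_ε([x,y])} f((ε/2)(x+y),η) φ(y) dy dη`. -/
def mOp {d : ℕ} (ε lam : ℝ) (A : Vd d → Vd d) (f : Vd d × Vd d → ℂ)
    (φ : Vd d → ℂ) (x : Vd d) : ℂ :=
  (((2 * Real.pi) ^ d)⁻¹ : ℝ) * ∫ y : Vd d, ∫ η : Vd d,
    Complex.exp (-Complex.I * dotR (y - x) η) *
      Complex.exp (-Complex.I * lam * circAe ε A x y) *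
      f ((ε / 2) • (x + y), η) * φ y

/-- The magnetic Wigner transform `W^A_{ε,λ}(φ,ψ)`. -/
def mWig {d : ℕ} (ε lam : ℝ) (A : Vd d → Vd d) (φ ψ : Vd d → ℂ)
    (X : Vd d × Vd d) : ℂ :=
  ∫ y : Vd d,
    Complex.exp (-Complex.I * dotR y X.2) *
      Complex.exp (-Complex.I * lam *
        circAe ε A (ε⁻¹ • X.1 - (2:ℝ)⁻¹ • y) (ε⁻¹ • X.1 + (2:ℝ)⁻¹ • y)) *
      (starRingEnd ℂ) (φ (ε⁻¹ • X.1 - (2:ℝ)⁻¹ • y)) * ψ (ε⁻¹ • X.1 + (2:ℝ)⁻¹ • y)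

/-- The magnetic Wigner transform of an operator kernel
`f(x,ξ) = ∫ e^{-iy·ξ} e^{-iλΓ^A_ε([x/ε-y/2, x/ε+y/2])} K(x/ε+y/2, x/ε-y/2) dy`. -/
def kerSymb {d : ℕ} (ε lam : ℝ) (A : Vd d → Vd d) (K : Vd d × Vd d → ℂ)
    (X : Vd d × Vd d) : ℂ :=
  ∫ y : Vd d,
    Complex.exp (-Complex.I * dotR y X.2) *
      Complex.exp (-Complex.I * lam *
        circAe ε A (ε⁻¹ • X.1 - (2:ℝ)⁻¹ • y) (ε⁻¹ • X.1 + (2:ℝ)⁻¹ • y)) *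
      K (ε⁻¹ • X.1 + (2:ℝ)⁻¹ • y, ε⁻¹ • X.1 - (2:ℝ)⁻¹ • y)

section ParametricInterval

variable {W : Type} [NormedAddCommGroup W] [NormedSpace ℝ W]

/-- Integration over the unit interval in the first variable. -/
def unitIntegral {F : Type} [NormedAddCommGroup F] [NormedSpace ℝ F] (a : ℝ × W → F) (w : W) : F :=
  ∫ s in Set.Ioc (0 : ℝ) 1, a (s, w)

theorem exists_norm_le_of_mem_Ioc {F : Type} [NormedAddCommGroup F] [NormedSpace ℝ F]
    {a : ℝ × W → F} (ha : a.HasTemperateGrowth) :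
    ∃ (k : ℕ) (C : ℝ), 0 ≤ C ∧ ∀ s ∈ Set.Ioc (0 : ℝ) 1, ∀ w, ‖a (s, w)‖ ≤ C * (1 + ‖w‖) ^ k := by
  obtain ⟨k, C, hC0, hC⟩ := ha.norm_iteratedFDeriv_le_uniform 0
  refine ⟨k, C * 2 ^ k, by positivity, fun s hs w ↦ ?_⟩
  have h := hC 0 le_rfl (s, w)
  rw [norm_iteratedFDeriv_zero] at h
  refine h.trans ?_
  rw [mul_assoc, ← mul_pow]
  gcongr
  have hs1 : ‖s‖ ≤ 1 := by
    rw [Real.norm_eq_abs, abs_le]; constructor <;> linarith [hs.1, hs.2]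
  have : ‖(s, w)‖ ≤ 1 + ‖w‖ := by
    rw [Prod.norm_def]
    exact max_le (by linarith [norm_nonneg w]) (by linarith)
  linarith [norm_nonneg w]

theorem hasTemperateGrowth_fderiv {E F : Type} [NormedAddCommGroup E] [NormedSpace ℝ E]
    [NormedAddCommGroup F] [NormedSpace ℝ F]
    {f : E → F} (hf : f.HasTemperateGrowth) : (fderiv ℝ f).HasTemperateGrowth := by
  refine ⟨(contDiff_infty_iff_fderiv.1 hf.1).2, fun n ↦ ?_⟩
  obtain ⟨k, C, hC⟩ := hf.2 (n + 1)
  exact ⟨k, C, fun x ↦ by rw [norm_iteratedFDeriv_fderiv]; exact hC x⟩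

theorem hasTemperateGrowth_comp_inr_fderiv {F : Type} [NormedAddCommGroup F] [NormedSpace ℝ F]
    {a : ℝ × W → F} (ha : a.HasTemperateGrowth) :
    (fun p : ℝ × W ↦ (fderiv ℝ a p).comp (ContinuousLinearMap.inr ℝ ℝ W)).HasTemperateGrowth :=
  ((ContinuousLinearMap.compL ℝ W (ℝ × W) F).flip
    (ContinuousLinearMap.inr ℝ ℝ W)).hasTemperateGrowth.comp (f := fderiv ℝ a)
      (hasTemperateGrowth_fderiv ha)

theorem hasFDerivAt_unitIntegral {F : Type} [NormedAddCommGroup F] [NormedSpace ℝ F]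
    {a : ℝ × W → F} (ha : a.HasTemperateGrowth) (w : W) :
    HasFDerivAt (unitIntegral a)
      (unitIntegral (fun p : ℝ × W ↦ (fderiv ℝ a p).comp (ContinuousLinearMap.inr ℝ ℝ W)) w) w := by
  obtain ⟨k, C, hC0, hC⟩ := exists_norm_le_of_mem_Ioc (hasTemperateGrowth_comp_inr_fderiv ha)
  have hac : Continuous a := ha.1.continuous
  refine hasFDerivAt_integral_of_dominated_of_fderiv_le
    (bound := fun _ ↦ C * (1 + (‖w‖ + 1)) ^ k)
    (F' := fun w s ↦ (fderiv ℝ a (s, w)).comp (ContinuousLinearMap.inr ℝ ℝ W))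
    (Metric.ball_mem_nhds w one_pos)
    (Filter.Eventually.of_forall fun x ↦ ?_) ?_ ?_ ?_ ?_ ?_
  · exact (hac.comp (by fun_prop)).aestronglyMeasurable
  · exact ((hac.comp (by fun_prop : Continuous fun s : ℝ ↦ (s, w))).integrableOn_Icc).mono_set
      Set.Ioc_subset_Icc_self
  · exact ((hasTemperateGrowth_comp_inr_fderiv ha).1.continuous.comp
      (by fun_prop : Continuous fun s : ℝ ↦ (s, w))).aestronglyMeasurable
  · filter_upwards [ae_restrict_mem measurableSet_Ioc] with s hs x hx
    refine (hC s hs x).trans ?_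
    have : ‖x‖ ≤ ‖w‖ + 1 := by
      have h1 : ‖x - w‖ < 1 := by simpa [dist_eq_norm] using hx
      have h2 := norm_le_norm_add_norm_sub' x w
      linarith
    gcongr
  · exact integrable_const _
  · refine Filter.Eventually.of_forall fun s x _ ↦ ?_
    have h1 : HasFDerivAt a (fderiv ℝ a (s, x)) (s, x) :=
      (ha.1.differentiable (by simp)).differentiableAt.hasFDerivAt
    exact h1.comp x (hasFDerivAt_prodMk_right s x)

theorem exists_norm_iteratedFDeriv_unitIntegral_le (n : ℕ) :
    ∀ {F : Type} [NormedAddCommGroup F] [NormedSpace ℝ F] {a : ℝ × W → F},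
      a.HasTemperateGrowth → ContDiff ℝ n (unitIntegral a) ∧
      ∃ (k : ℕ) (C : ℝ), ∀ w, ‖iteratedFDeriv ℝ n (unitIntegral a) w‖ ≤ C * (1 + ‖w‖) ^ k := by
  induction n with
  | zero =>
    intro F _ _ a ha
    refine ⟨contDiff_zero.2 (continuous_iff_continuousAt.2 fun w ↦
      (hasFDerivAt_unitIntegral ha w).continuousAt), ?_⟩
    obtain ⟨k, C, hC0, hC⟩ := exists_norm_le_of_mem_Ioc ha
    refine ⟨k, C, fun w ↦ ?_⟩
    rw [norm_iteratedFDeriv_zero]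
    have := norm_setIntegral_le_of_norm_le_const (μ := volume) (s := Set.Ioc (0 : ℝ) 1)
      (f := fun s ↦ a (s, w)) (C := C * (1 + ‖w‖) ^ k) (by simp) fun s hs ↦ hC s hs w
    simpa [unitIntegral] using this
  | succ n ih =>
    intro F _ _ a ha
    have hd : fderiv ℝ (unitIntegral a) =
        unitIntegral (fun p ↦ (fderiv ℝ a p).comp (ContinuousLinearMap.inr ℝ ℝ W)) :=
      funext fun w ↦ (hasFDerivAt_unitIntegral ha w).fderiv
    obtain ⟨h1, k, C, hC⟩ := ih (hasTemperateGrowth_comp_inr_fderiv ha)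
    refine ⟨?_, k, C, fun w ↦ ?_⟩
    · push_cast
      refine contDiff_succ_iff_fderiv.2
        ⟨fun w ↦ (hasFDerivAt_unitIntegral ha w).differentiableAt, by simp, hd ▸ h1⟩
    · rw [← norm_iteratedFDeriv_fderiv, hd]
      exact hC w

theorem hasTemperateGrowth_unitIntegral {F : Type} [NormedAddCommGroup F] [NormedSpace ℝ F]
    {a : ℝ × W → F} (ha : a.HasTemperateGrowth) : (unitIntegral a).HasTemperateGrowth :=
  ⟨contDiff_infty.2 fun n ↦ (exists_norm_iteratedFDeriv_unitIntegral_le n ha).1,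
    fun n ↦ (exists_norm_iteratedFDeriv_unitIntegral_le n ha).2⟩

end ParametricInterval

theorem hasTemperateGrowth_cexp_mul_I (c : ℝ) :
    (fun t : ℝ ↦ Complex.exp (-Complex.I * c * t)).HasTemperateGrowth := by
  have hd : ∀ n, iteratedDeriv n (fun t : ℝ ↦ Complex.exp (-Complex.I * c * t)) =
      fun t : ℝ ↦ (-Complex.I * c) ^ n * Complex.exp (-Complex.I * c * t) := by
    intro n
    induction n with
    | zero => simp
    | succ n ih =>
      rw [iteratedDeriv_succ, ih]
      funext t
      have h : HasDerivAt (fun t : ℝ ↦ -Complex.I * c * t) (-Complex.I * c * 1) t :=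
        (Complex.ofRealCLM.hasDerivAt (x := t)).const_mul _
      rw [(h.cexp.const_mul _).deriv]
      ring
  refine ⟨?_, fun n ↦ ⟨0, |c| ^ n, fun t ↦ ?_⟩⟩
  · exact (contDiff_const.mul Complex.ofRealCLM.contDiff).cexp
  · rw [norm_iteratedFDeriv_eq_norm_iteratedDeriv, hd]
    have : ‖Complex.exp (-Complex.I * c * t)‖ = 1 := by
      simpa [mul_comm, mul_left_comm, mul_assoc] using Complex.norm_exp_ofReal_mul_I (-(c * t))
    rw [norm_mul, this]
    simp

theorem hasTemperateGrowth_circAe {d : ℕ} (ε : ℝ) {A : Vd d → Vd d}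
    (hA : ∀ l, CPol fun x : Vd d => A x l) :
    (fun p : Vd d × Vd d ↦ circAe ε A p.1 p.2).HasTemperateGrowth := by
  have hA' (l : Fin d) : (fun x : Vd d ↦ A x l).HasTemperateGrowth :=
    ⟨(hA l).1, fun n ↦ let ⟨C, k, h⟩ := (hA l).2 n; ⟨k, C, h⟩⟩
  unfold circAe circA
  refine .fun_mul (.const _) (.sum fun l _ ↦ .fun_mul ?_ ?_)
  · exact ((ContinuousLinearMap.proj (R := ℝ) (φ := fun _ : Fin d ↦ ℝ) l).comp
      (ε • ContinuousLinearMap.snd ℝ (Vd d) (Vd d) -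
        ε • ContinuousLinearMap.fst ℝ (Vd d) (Vd d))).hasTemperateGrowth
  · have h : (fun q : ℝ × Vd d × Vd d ↦
        A (ε • q.2.1 + q.1 • (ε • q.2.2 - ε • q.2.1)) l).HasTemperateGrowth := by
      refine (hA' l).comp (f := fun q : ℝ × Vd d × Vd d ↦
        ε • q.2.1 + q.1 • (ε • q.2.2 - ε • q.2.1)) ?_
      have h1 : (fun q : ℝ × Vd d × Vd d ↦ ε • q.2.1).HasTemperateGrowth :=
        (ε • (ContinuousLinearMap.fst ℝ _ _).comp (.snd ℝ ℝ (Vd d × Vd d))).hasTemperateGrowth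
      have h2 : (fun q : ℝ × Vd d × Vd d ↦ ε • q.2.2).HasTemperateGrowth :=
        (ε • (ContinuousLinearMap.snd ℝ _ _).comp (.snd ℝ ℝ (Vd d × Vd d))).hasTemperateGrowth
      have h3 : (fun q : ℝ × Vd d × Vd d ↦ q.1).HasTemperateGrowth :=
        (ContinuousLinearMap.fst ℝ ℝ (Vd d × Vd d)).hasTemperateGrowth
      exact h1.add (h3.smul (h2.sub h1))
    have := hasTemperateGrowth_unitIntegral h
    simpa only [unitIntegral, intervalIntegral.integral_of_le zero_le_one] using! this

section PartialFourier

open scoped SchwartzMap LineDeriv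

variable {d : ℕ}

/-- The dot product as a continuous bilinear map. -/
def dotCLM (d : ℕ) : Vd d →L[ℝ] Vd d →L[ℝ] ℝ :=
  ∑ l, (ContinuousLinearMap.proj (R := ℝ) (φ := fun _ : Fin d ↦ ℝ) l).smulRight
    (ContinuousLinearMap.proj (R := ℝ) (φ := fun _ : Fin d ↦ ℝ) l)

theorem dotCLM_apply (x y : Vd d) : dotCLM d x y = dotR x y := by
  simp [dotCLM, dotR]

theorem dotR_comm (x y : Vd d) : dotR x y = dotR y x := by
  simp [dotR, mul_comm]

theorem norm_cexp_dotR (y ξ : Vd d) : ‖Complex.exp (-Complex.I * dotR y ξ)‖ = 1 := by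
  simpa [mul_comm] using Complex.norm_exp_ofReal_mul_I (-(dotR y ξ))

/-- Partial Fourier transform in the second variable. -/
def partialFourier {F : Type} [NormedAddCommGroup F] [NormedSpace ℝ F] [NormedSpace ℂ F]
    (G : 𝓢(Vd d × Vd d, F)) (X : Vd d × Vd d) : F :=
  ∫ y : Vd d, Complex.exp (-Complex.I * dotR y X.2) • G (X.1, y)

section
variable {F : Type} [NormedAddCommGroup F] [NormedSpace ℝ F]

theorem exists_pow_mul_norm_le (G : 𝓢(Vd d × Vd d, F)) (k : ℕ) :
    ∃ C : ℝ, ∀ x y, ‖x‖ ^ k * ‖G (x, y)‖ ≤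
      C * (1 + ‖y‖) ^ (-((volume : Measure (Vd d)).integrablePower : ℝ)) := by
  obtain ⟨C₁, -, h₁⟩ := G.decay k 0
  obtain ⟨C₂, -, h₂⟩ := G.decay (k + (volume : Measure (Vd d)).integrablePower) 0
  simp only [norm_iteratedFDeriv_zero] at h₁ h₂
  refine ⟨2 ^ (volume : Measure (Vd d)).integrablePower * (C₁ + C₂), fun x y ↦ ?_⟩
  have h := pow_mul_le_of_le_of_pow_mul_le (x := ‖y‖) (f := ‖x‖ ^ k * ‖G (x, y)‖) (k := 0)
    (l := (volume : Measure (Vd d)).integrablePower) (C₁ := C₁) (C₂ := C₂) (norm_nonneg _)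
    (by positivity) ?_ ?_
  · simpa using h
  · refine le_trans ?_ (h₁ (x, y))
    gcongr
    exact norm_fst_le (x, y)
  · refine le_trans ?_ (h₂ (x, y))
    rw [zero_add, ← mul_assoc, pow_add, mul_comm (‖y‖ ^ _)]
    gcongr
    · exact norm_fst_le (x, y)
    · exact norm_snd_le (x, y)

theorem integrable_slice (G : 𝓢(Vd d × Vd d, F)) (x : Vd d) :
    Integrable fun y ↦ G (x, y) := by
  obtain ⟨C, hC⟩ := exists_pow_mul_norm_le G 0
  refine ((Measure.integrable_pow_neg_integrablePower (volume : Measure (Vd d))).const_mul C).mono'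
    (G.continuous.comp (by fun_prop)).aestronglyMeasurable (.of_forall fun y ↦ ?_)
  simpa using hC x y

variable [NormedSpace ℂ F]

theorem integrable_cexp_smul_slice (G : 𝓢(Vd d × Vd d, F)) (x ξ : Vd d) :
    Integrable fun y ↦ Complex.exp (-Complex.I * dotR y ξ) • G (x, y) := by
  refine (integrable_slice G x).norm.mono' ?_ (.of_forall fun y ↦ ?_)
  · have h1 : Continuous fun y ↦ dotR y ξ := by
      unfold dotR; fun_prop
    have h2 : Continuous fun y ↦ G (x, y) := G.continuous.comp (by fun_prop)
    exact Continuous.aestronglyMeasurable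
      ((continuous_const.mul (Complex.continuous_ofReal.comp h1)).cexp.smul h2)
  · rw [norm_smul, norm_cexp_dotR, one_mul]

theorem exists_pow_fst_mul_norm_partialFourier_le (G : 𝓢(Vd d × Vd d, F)) (k : ℕ) :
    ∃ C : ℝ, ∀ X : Vd d × Vd d, ‖X.1‖ ^ k * ‖partialFourier G X‖ ≤ C := by
  obtain ⟨C, hC⟩ := exists_pow_mul_norm_le G k
  refine ⟨∫ y : Vd d, C * (1 + ‖y‖) ^ (-((volume : Measure (Vd d)).integrablePower : ℝ)),
    fun X ↦ ?_⟩
  calc ‖X.1‖ ^ k * ‖partialFourier G X‖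
      ≤ ‖X.1‖ ^ k * ∫ y, ‖Complex.exp (-Complex.I * dotR y X.2) • G (X.1, y)‖ := by
        gcongr; exact norm_integral_le_integral_norm _
    _ = ∫ y, ‖X.1‖ ^ k * ‖Complex.exp (-Complex.I * dotR y X.2) • G (X.1, y)‖ :=
        (integral_const_mul _ _).symm
    _ ≤ _ := by
        refine integral_mono ((integrable_cexp_smul_slice G _ _).norm.const_mul _)
          ((Measure.integrable_pow_neg_integrablePower _).const_mul C) fun y ↦ ?_
        simp only [norm_smul, norm_cexp_dotR, one_mul]
        exact hC X.1 y

variable [IsScalarTower ℝ ℂ F]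

/-- The Schwartz function whose partial Fourier transform is the derivative of that of `G`. -/
def fourierDeriv (G : 𝓢(Vd d × Vd d, F)) : 𝓢(Vd d × Vd d, Vd d × Vd d →L[ℝ] F) :=
  SchwartzMap.postcompCLM (𝕜 := ℝ)
    ((ContinuousLinearMap.compL ℝ (Vd d × Vd d) (Vd d × Vd d) F).flip
      ((ContinuousLinearMap.inl ℝ (Vd d) (Vd d)).comp (.fst ℝ (Vd d) (Vd d))))
    (SchwartzMap.fderivCLM ℝ (Vd d × Vd d) F G) +
  (-Complex.I) • SchwartzMap.smulRightCLM ℝ F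
    ((((ContinuousLinearMap.compL ℝ (Vd d × Vd d) (Vd d) ℝ).flip (.snd ℝ (Vd d) (Vd d))).comp
      (dotCLM d)).comp (.snd ℝ (Vd d) (Vd d))) G

theorem fourierDeriv_apply (G : 𝓢(Vd d × Vd d, F)) (p v : Vd d × Vd d) :
    fourierDeriv G p v = fderiv ℝ G p (v.1, 0) + (-Complex.I * dotR p.2 v.2) • G p := by
  rw [mul_smul, ← Complex.coe_algebraMap, algebraMap_smul]
  simp [fourierDeriv, dotCLM_apply]

theorem hasFDerivAt_cexp_smul (G : 𝓢(Vd d × Vd d, F)) (y : Vd d) (X : Vd d × Vd d) :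
    HasFDerivAt (fun X : Vd d × Vd d ↦ Complex.exp (-Complex.I * dotR y X.2) • G (X.1, y))
      (Complex.exp (-Complex.I * dotR y X.2) • fourierDeriv G (X.1, y)) X := by
  have h1 : HasFDerivAt (fun X : Vd d × Vd d ↦ -Complex.I * (dotR y X.2 : ℂ))
      ((-Complex.I) • (Complex.ofRealCLM.comp ((dotCLM d y).comp (.snd ℝ (Vd d) (Vd d))))) X := by
    have := (Complex.ofRealCLM.comp
      ((dotCLM d y).comp (.snd ℝ (Vd d) (Vd d)))).hasFDerivAt (x := X)
    simpa [dotCLM_apply] using! this.const_mul (-Complex.I)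
  have h2 : HasFDerivAt (fun X : Vd d × Vd d ↦ G (X.1, y))
      ((fderiv ℝ G (X.1, y)).comp
        ((ContinuousLinearMap.inl ℝ (Vd d) (Vd d)).comp (.fst ℝ (Vd d) (Vd d)))) X :=
    (G.hasFDerivAt (X.1, y)).comp X
      (HasFDerivAt.comp (g := fun x ↦ (x, y)) X (hasFDerivAt_prodMk_left X.1 y) hasFDerivAt_fst)
  refine (h1.cexp.smul h2).congr_fderiv (ContinuousLinearMap.ext fun v ↦ ?_)
  rw [smul_apply, fourierDeriv_apply]
  simp [dotCLM_apply, smul_smul]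
  ring_nf

theorem hasFDerivAt_partialFourier (G : 𝓢(Vd d × Vd d, F)) (X : Vd d × Vd d) :
    HasFDerivAt (partialFourier G) (partialFourier (fourierDeriv G) X) X := by
  obtain ⟨C, hC⟩ := exists_pow_mul_norm_le (fourierDeriv G) 0
  refine hasFDerivAt_integral_of_dominated_of_fderiv_le (s := Set.univ)
    (F' := fun X y ↦ Complex.exp (-Complex.I * dotR y X.2) • fourierDeriv G (X.1, y))
    (bound := fun y ↦ C * (1 + ‖y‖) ^ (-((volume : Measure (Vd d)).integrablePower : ℝ)))
    Filter.univ_mem (.of_forall fun Y ↦ ?_) ?_ ?_ ?_ ?_ ?_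
  · exact (integrable_cexp_smul_slice G _ _).aestronglyMeasurable
  · exact integrable_cexp_smul_slice G _ _
  · exact (integrable_cexp_smul_slice (fourierDeriv G) _ _).aestronglyMeasurable
  · refine .of_forall fun y Y _ ↦ ?_
    rw [norm_smul, norm_cexp_dotR]
    simpa using hC Y.1 y
  · exact (Measure.integrable_pow_neg_integrablePower _).const_mul C
  · exact .of_forall fun y Y _ ↦ hasFDerivAt_cexp_smul G y Y

theorem fderiv_partialFourier (G : 𝓢(Vd d × Vd d, F)) :
    fderiv ℝ (partialFourier G) = partialFourier (fourierDeriv G) :=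
  funext fun X ↦ (hasFDerivAt_partialFourier G X).fderiv

theorem partialFourier_lineDeriv (G : 𝓢(Vd d × Vd d, F)) (l : Fin d) (X : Vd d × Vd d) :
    partialFourier (∂_{((0 : Vd d), (Pi.single l 1 : Vd d))} G) X =
      (Complex.I * X.2 l) • partialFourier G X := by
  have hexp (y : Vd d) : HasFDerivAt (fun y : Vd d ↦ Complex.exp (-Complex.I * dotR y X.2))
      (Complex.exp (-Complex.I * dotR y X.2) • (-Complex.I) •
        (Complex.ofRealCLM.comp (dotCLM d X.2))) y := by
    have h := ((Complex.ofRealCLM.comp (dotCLM d X.2)).hasFDerivAt (x := y)).const_mul (-Complex.I)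
    simpa [dotCLM_apply, dotR_comm X.2] using! h.cexp
  have hG (y : Vd d) : HasFDerivAt (fun y ↦ G (X.1, y))
      ((fderiv ℝ G (X.1, y)).comp (ContinuousLinearMap.inr ℝ (Vd d) (Vd d))) y :=
    (G.hasFDerivAt (X.1, y)).comp y (hasFDerivAt_prodMk_right X.1 y)
  have hdot : dotR X.2 (Pi.single l 1) = X.2 l := by simp [dotR, Pi.single_apply]
  have key := integral_bilinear_hasFDerivAt_right_eq_neg_left_of_integrable
    (μ := (volume : Measure (Vd d))) (v := (Pi.single l 1 : Vd d))
    (B := ContinuousLinearMap.lsmul ℝ ℂ (E := F))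
    (f := fun y ↦ Complex.exp (-Complex.I * dotR y X.2)) (g := fun y ↦ G (X.1, y))
    (f' := fun y ↦ Complex.exp (-Complex.I * dotR y X.2) • (-Complex.I) •
        (Complex.ofRealCLM.comp (dotCLM d X.2)))
    (g' := fun y ↦ (fderiv ℝ G (X.1, y)).comp (ContinuousLinearMap.inr ℝ (Vd d) (Vd d)))
    ?_ ?_ ?_ (fun y _ ↦ hexp y) (fun y _ ↦ hG y)
  · have e : ∀ y, Complex.exp (-Complex.I * dotR y X.2) * (-(Complex.I * X.2 l)) =
        -((Complex.I * X.2 l) * Complex.exp (-Complex.I * dotR y X.2)) := fun y ↦ by ring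
    simp only [ContinuousLinearMap.lsmul_apply, ContinuousLinearMap.comp_apply,
      smul_apply, dotCLM_apply, hdot, ContinuousLinearMap.inr_apply,
      Complex.ofRealCLM_apply, smul_eq_mul, neg_mul, mul_neg, neg_smul, integral_neg, neg_neg]
      at key
    simp only [partialFourier, SchwartzMap.lineDerivOp_apply_eq_fderiv, neg_mul]
    rw [key, ← integral_smul]
    congr 1
    funext y
    rw [smul_smul]
    ring_nf
  · have := (integrable_cexp_smul_slice G X.1 X.2).smul (-Complex.I * X.2 l)
    refine this.congr (.of_forall fun y ↦ ?_)
    simp [dotCLM_apply, hdot, smul_smul]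
    ring_nf
  · refine (integrable_cexp_smul_slice
      (∂_{((0 : Vd d), (Pi.single l 1 : Vd d))} G) X.1 X.2).congr (.of_forall fun y ↦ ?_)
    simp [SchwartzMap.lineDerivOp_apply_eq_fderiv]
  · exact integrable_cexp_smul_slice G X.1 X.2

theorem exists_pow_snd_mul_norm_partialFourier_le (k : ℕ) : ∀ G : 𝓢(Vd d × Vd d, F),
    ∃ C : ℝ, ∀ X : Vd d × Vd d, ‖X.2‖ ^ k * ‖partialFourier G X‖ ≤ C := by
  induction k with
  | zero => exact fun G ↦ by simpa using exists_pow_fst_mul_norm_partialFourier_le G 0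
  | succ k ih =>
    intro G
    choose C hC using fun l : Fin d ↦ ih (∂_{((0 : Vd d), (Pi.single l 1 : Vd d))} G)
    refine ⟨∑ l, C l, fun X ↦ ?_⟩
    have hsum : ‖X.2‖ ≤ ∑ l, ‖X.2 l‖ :=
      (pi_norm_le_iff_of_nonneg (Finset.sum_nonneg fun _ _ ↦ norm_nonneg _)).2 fun l ↦
        Finset.single_le_sum (f := fun l ↦ ‖X.2 l‖) (fun _ _ ↦ norm_nonneg _) (Finset.mem_univ l)
    calc ‖X.2‖ ^ (k + 1) * ‖partialFourier G X‖
        = ‖X.2‖ * (‖X.2‖ ^ k * ‖partialFourier G X‖) := by ring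
      _ ≤ (∑ l, ‖X.2 l‖) * (‖X.2‖ ^ k * ‖partialFourier G X‖) := by gcongr
      _ = ∑ l, ‖X.2‖ ^ k * ‖partialFourier (∂_{((0 : Vd d), (Pi.single l 1 : Vd d))} G) X‖ := by
          rw [Finset.sum_mul]
          refine Finset.sum_congr rfl fun l _ ↦ ?_
          rw [partialFourier_lineDeriv, norm_smul, norm_mul, Complex.norm_I, Complex.norm_real]
          ring
      _ ≤ ∑ l, C l := Finset.sum_le_sum fun l _ ↦ hC l X

theorem exists_pow_mul_norm_partialFourier_le (G : 𝓢(Vd d × Vd d, F)) (k : ℕ) :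
    ∃ C : ℝ, ∀ X : Vd d × Vd d, ‖X‖ ^ k * ‖partialFourier G X‖ ≤ C := by
  obtain ⟨C₁, h₁⟩ := exists_pow_fst_mul_norm_partialFourier_le G k
  obtain ⟨C₂, h₂⟩ := exists_pow_snd_mul_norm_partialFourier_le k G
  refine ⟨max C₁ C₂, fun X ↦ ?_⟩
  rcases le_total ‖X.1‖ ‖X.2‖ with h | h
  · rw [Prod.norm_def, max_eq_right h]
    exact (h₂ X).trans (le_max_right _ _)
  · rw [Prod.norm_def, max_eq_left h]
    exact (h₁ X).trans (le_max_left _ _)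

end

theorem partialFourier_contDiff_and_decay (n : ℕ) :
    ∀ {F : Type} [NormedAddCommGroup F] [NormedSpace ℝ F] [NormedSpace ℂ F] [IsScalarTower ℝ ℂ F]
      (G : 𝓢(Vd d × Vd d, F)), ContDiff ℝ n (partialFourier G) ∧
      ∀ k : ℕ, ∃ C : ℝ, ∀ X, ‖X‖ ^ k * ‖iteratedFDeriv ℝ n (partialFourier G) X‖ ≤ C := by
  induction n with
  | zero =>
    intro F _ _ _ _ G
    refine ⟨contDiff_zero.2 (continuous_iff_continuousAt.2 fun X ↦
      (hasFDerivAt_partialFourier G X).continuousAt), fun k ↦ ?_⟩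
    simpa only [norm_iteratedFDeriv_zero] using exists_pow_mul_norm_partialFourier_le G k
  | succ n ih =>
    intro F _ _ _ _ G
    obtain ⟨h1, h2⟩ := ih (fourierDeriv G)
    refine ⟨?_, fun k ↦ ?_⟩
    · push_cast
      exact contDiff_succ_iff_fderiv.2
        ⟨fun X ↦ (hasFDerivAt_partialFourier G X).differentiableAt, by simp,
          (fderiv_partialFourier G) ▸ h1⟩
    · simpa only [← norm_iteratedFDeriv_fderiv, fderiv_partialFourier] using h2 k

/-- The partial Fourier transform of a Schwartz function, as a Schwartz function. -/
def partialFourierSchwartz (G : 𝓢(Vd d × Vd d, ℂ)) : 𝓢(Vd d × Vd d, ℂ) where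
  toFun := partialFourier G
  smooth' := contDiff_infty.2 fun n ↦ (partialFourier_contDiff_and_decay n G).1
  decay' k n := (partialFourier_contDiff_and_decay n G).2 k

theorem partialFourierSchwartz_apply (G : 𝓢(Vd d × Vd d, ℂ)) (X : Vd d × Vd d) :
    partialFourierSchwartz G X = partialFourier G X := rfl

theorem mul_inner_eq_dotR (c : ℝ) (v w : EuclideanSpace ℝ (Fin d)) :
    c * inner ℝ v w = dotR v.ofLp (c • w.ofLp) := by
  simp only [PiLp.inner_apply, dotR, Finset.mul_sum, Pi.smul_apply, smul_eq_mul,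
    RCLike.inner_apply, conj_trivial]
  exact Finset.sum_congr rfl fun _ _ ↦ by ring

open scoped FourierTransform in
theorem fourier_slice (G : 𝓢(Vd d × Vd d, ℂ)) (x : Vd d) (w : EuclideanSpace ℝ (Fin d)) :
    𝓕 (fun v : EuclideanSpace ℝ (Fin d) ↦ G (x, v.ofLp)) w =
      partialFourier G (x, (2 * Real.pi) • w.ofLp) := by
  rw [Real.fourier_eq', partialFourier, ← (PiLp.volume_preserving_ofLp (Fin d)).integral_comp
    (MeasurableEquiv.toLp 2 (Fin d → ℝ)).symm.measurableEmbedding]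
  refine integral_congr_ae (.of_forall fun v ↦ ?_)
  simp only [← mul_inner_eq_dotR, neg_mul, smul_eq_mul]
  push_cast
  ring_nf

open scoped FourierTransform in
theorem integral_cexp_mul_partialFourier (G : 𝓢(Vd d × Vd d, ℂ)) (x z : Vd d) :
    ∫ η : Vd d, Complex.exp (Complex.I * dotR z η) * partialFourier G (x, η) =
      ((2 * Real.pi) ^ d : ℝ) * G (x, z) := by
  set g : EuclideanSpace ℝ (Fin d) → ℂ := fun v ↦ G (x, v.ofLp)
  have hmp := PiLp.volume_preserving_ofLp (Fin d)
  have hemb : MeasurableEmbedding (WithLp.ofLp : EuclideanSpace ℝ (Fin d) → Fin d → ℝ) :=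
    (MeasurableEquiv.toLp 2 (Fin d → ℝ)).symm.measurableEmbedding
  have hF : 𝓕 g = fun w ↦ partialFourier G (x, (2 * Real.pi) • w.ofLp) :=
    funext fun w ↦ fourier_slice G x w
  have hπ : (2 * Real.pi) ≠ 0 := by positivity
  have hgi : Integrable g := (hmp.integrable_comp_emb hemb).2 (integrable_slice G x)
  have hFi : Integrable (𝓕 g) := by
    rw [hF]
    exact (hmp.integrable_comp_emb hemb).2
      ((integrable_slice (partialFourierSchwartz G) x).comp_smul hπ)
  have hgc : Continuous g := G.continuous.comp (by fun_prop)
  have hinv := congrFun (hgc.fourierInv_fourier_eq hgi hFi) (WithLp.toLp 2 z)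
  rw [Real.fourierInv_eq', hF] at hinv
  have hscale := Measure.integral_comp_smul_of_nonneg (volume : Measure (Vd d))
    (fun η ↦ Complex.exp (Complex.I * dotR z η) * partialFourier G (x, η)) (2 * Real.pi)
    (hR := by positivity)
  rw [← hmp.integral_comp hemb, Module.finrank_fin_fun] at hscale
  have hpow : ((2 * Real.pi) ^ d : ℝ) ≠ 0 := pow_ne_zero _ hπ
  rw [← Complex.real_smul, ← inv_smul_eq_iff₀ hpow, ← hscale]
  refine Eq.trans (integral_congr_ae (.of_forall fun v ↦ ?_)) hinv
  simp only [← real_inner_comm v, mul_inner_eq_dotR, smul_eq_mul, mul_comm Complex.I]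

end PartialFourier

/-- The linear change of variables `(x, y) ↦ (x/ε + y/2, x/ε - y/2)`. -/
def wignerEquiv (d : ℕ) {ε : ℝ} (hε : ε ≠ 0) : (Vd d × Vd d) ≃L[ℝ] (Vd d × Vd d) :=
  ContinuousLinearEquiv.equivOfInverse
    ((ε⁻¹ • ContinuousLinearMap.fst ℝ (Vd d) (Vd d) +
        (2 : ℝ)⁻¹ • ContinuousLinearMap.snd ℝ (Vd d) (Vd d)).prod
      (ε⁻¹ • ContinuousLinearMap.fst ℝ (Vd d) (Vd d) -
        (2 : ℝ)⁻¹ • ContinuousLinearMap.snd ℝ (Vd d) (Vd d)))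
    (((ε / 2) • (ContinuousLinearMap.fst ℝ (Vd d) (Vd d) +
        ContinuousLinearMap.snd ℝ (Vd d) (Vd d))).prod
      (ContinuousLinearMap.fst ℝ (Vd d) (Vd d) - ContinuousLinearMap.snd ℝ (Vd d) (Vd d)))
    (fun p ↦ by
      ext i <;> simp <;> field_simp <;> ring)
    (fun p ↦ by
      ext i <;> simp <;> field_simp <;> ring)

theorem wignerEquiv_apply {d : ℕ} {ε : ℝ} (hε : ε ≠ 0) (p : Vd d × Vd d) :
    wignerEquiv d hε p = (ε⁻¹ • p.1 + (2 : ℝ)⁻¹ • p.2, ε⁻¹ • p.1 - (2 : ℝ)⁻¹ • p.2) := rfl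

/-- The magnetic phase in the coordinates of the Wigner transform. -/
def wignerPhase {d : ℕ} (ε lam : ℝ) (A : Vd d → Vd d) (p : Vd d × Vd d) : ℂ :=
  Complex.exp (-Complex.I * lam *
    circAe ε A (ε⁻¹ • p.1 - (2 : ℝ)⁻¹ • p.2) (ε⁻¹ • p.1 + (2 : ℝ)⁻¹ • p.2))

theorem hasTemperateGrowth_wignerPhase {d : ℕ} (ε lam : ℝ) {A : Vd d → Vd d}
    (hA : ∀ l, CPol fun x : Vd d => A x l) : (wignerPhase ε lam A).HasTemperateGrowth := by
  have h := (hasTemperateGrowth_circAe ε hA).comp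
    ((ε⁻¹ • ContinuousLinearMap.fst ℝ (Vd d) (Vd d) -
        (2 : ℝ)⁻¹ • ContinuousLinearMap.snd ℝ (Vd d) (Vd d)).prod
      (ε⁻¹ • ContinuousLinearMap.fst ℝ (Vd d) (Vd d) +
        (2 : ℝ)⁻¹ • ContinuousLinearMap.snd ℝ (Vd d) (Vd d))).hasTemperateGrowth
  exact (hasTemperateGrowth_cexp_mul_I lam).comp h

/-- The kernel, in the coordinates of the Wigner transform, times the magnetic phase. -/
def wignerKernel {d : ℕ} {ε : ℝ} (hε : ε ≠ 0) (lam : ℝ) (A : Vd d → Vd d)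
    (K : SchwartzMap (Vd d × Vd d) ℂ) : SchwartzMap (Vd d × Vd d) ℂ :=
  SchwartzMap.smulLeftCLM ℂ (wignerPhase ε lam A)
    (SchwartzMap.compCLMOfContinuousLinearEquiv ℂ (wignerEquiv d hε) K)

theorem wignerKernel_apply {d : ℕ} {ε : ℝ} (hε : ε ≠ 0) (lam : ℝ) {A : Vd d → Vd d}
    (hA : ∀ l, CPol fun x : Vd d => A x l) (K : SchwartzMap (Vd d × Vd d) ℂ) (p : Vd d × Vd d) :
    wignerKernel hε lam A K p = wignerPhase ε lam A p *
      K (ε⁻¹ • p.1 + (2 : ℝ)⁻¹ • p.2, ε⁻¹ • p.1 - (2 : ℝ)⁻¹ • p.2) := by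
  rw [wignerKernel, SchwartzMap.smulLeftCLM_apply_apply (hasTemperateGrowth_wignerPhase ε lam hA)]
  simp [wignerEquiv_apply]

theorem kerSymb_eq_partialFourier {d : ℕ} {ε : ℝ} (hε : ε ≠ 0) (lam : ℝ) {A : Vd d → Vd d}
    (hA : ∀ l, CPol fun x : Vd d => A x l) (K : SchwartzMap (Vd d × Vd d) ℂ) :
    kerSymb ε lam A K = partialFourier (wignerKernel hε lam A K) := by
  funext X
  simp only [kerSymb, partialFourier, wignerKernel_apply hε lam hA, wignerPhase, smul_eq_mul,
    mul_assoc]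

theorem circA_swap {d : ℕ} (A : Vd d → Vd d) (u v : Vd d) : circA A v u = -circA A u v := by
  rw [circA, circA, ← Finset.sum_neg_distrib]
  refine Finset.sum_congr rfl fun l _ ↦ ?_
  have h := intervalIntegral.integral_comp_sub_left (a := 0) (b := 1)
    (fun s : ℝ ↦ A (u + s • (v - u)) l) 1
  rw [sub_self, sub_zero] at h
  rw [← h, ← neg_mul, neg_sub]
  congr 2
  funext s
  rw [show v + s • (u - v) = u + (1 - s) • (v - u) by module]

theorem circAe_swap {d : ℕ} (ε : ℝ) (A : Vd d → Vd d) (u v : Vd d) :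
    circAe ε A v u = -circAe ε A u v := by
  rw [circAe, circAe, circA_swap, mul_neg]

theorem mOp_kerSymb {d : ℕ} {ε : ℝ} (hε : ε ≠ 0) (lam : ℝ) {A : Vd d → Vd d}
    (hA : ∀ l, CPol fun x : Vd d => A x l) (K : SchwartzMap (Vd d × Vd d) ℂ)
    (φ : Vd d → ℂ) (x : Vd d) :
    mOp ε lam A (kerSymb ε lam A K) φ x = ∫ y : Vd d, K (x, y) * φ y := by
  rw [mOp, ← integral_const_mul]
  congr 1
  funext y
  have hu : ε⁻¹ • (ε / 2) • (x + y) + (2 : ℝ)⁻¹ • (x - y) = x := by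
    ext i; simp; field_simp; ring
  have hv : ε⁻¹ • (ε / 2) • (x + y) - (2 : ℝ)⁻¹ • (x - y) = y := by
    ext i; simp; field_simp; ring
  have hη (η : Vd d) : Complex.exp (-Complex.I * dotR (y - x) η) *
      Complex.exp (-Complex.I * lam * circAe ε A x y) *
      kerSymb ε lam A K ((ε / 2) • (x + y), η) * φ y =
      (Complex.exp (-Complex.I * lam * circAe ε A x y) * φ y) *
      (Complex.exp (Complex.I * dotR (x - y) η) *
        partialFourier (wignerKernel hε lam A K) ((ε / 2) • (x + y), η)) := by
    have : dotR (y - x) η = -dotR (x - y) η := by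
      simp only [dotR, ← Finset.sum_neg_distrib, Pi.sub_apply]
      exact Finset.sum_congr rfl fun _ _ ↦ by ring
    rw [kerSymb_eq_partialFourier hε lam hA, this]
    push_cast
    rw [neg_mul_neg]
    ring
  simp only [hη]
  rw [integral_const_mul, integral_cexp_mul_partialFourier, wignerKernel_apply hε lam hA,
    wignerPhase]
  simp only [hu, hv]
  have hexp : Complex.exp (-Complex.I * lam * circAe ε A x y) *
      Complex.exp (-Complex.I * lam * circAe ε A y x) = 1 := by
    rw [← Complex.exp_add, circAe_swap ε A x y]
    push_cast
    rw [mul_neg, add_neg_cancel, Complex.exp_zero]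
  have hpow : (((2 * Real.pi) ^ d : ℝ) : ℂ) ≠ 0 :=
    Complex.ofReal_ne_zero.2 (pow_ne_zero _ (by positivity))
  rw [Complex.ofReal_inv]
  calc _ = ((((2 * Real.pi) ^ d : ℝ) : ℂ)⁻¹ * (((2 * Real.pi) ^ d : ℝ) : ℂ)) *
        (Complex.exp (-Complex.I * lam * circAe ε A x y) *
          Complex.exp (-Complex.I * lam * circAe ε A y x)) * (K (x, y) * φ y) := by ring
    _ = _ := by rw [hexp, inv_mul_cancel₀ hpow, one_mul, one_mul]

/-- Inverse magnetic quantization: for an integral operator `T` with Schwartz kernel `K`,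
the magnetic Wigner transform `f` of the kernel is a Schwartz function and satisfies
`Op^A_{ε,λ}(f) = T`. -/
theorem statement6 (d : ℕ) (hd : 1 ≤ d) (ε : ℝ) (hε : 0 < ε) (lam : ℝ)
    (A : Vd d → Vd d) (hA : ∀ l, CPol fun x : Vd d => A x l)
    (K : SchwartzMap (Vd d × Vd d) ℂ) :
    (∃ F : SchwartzMap (Vd d × Vd d) ℂ,
      ∀ X : Vd d × Vd d, F X = kerSymb ε lam A (⇑K) X) ∧
    ∀ (φ : SchwartzMap (Vd d) ℂ) (x : Vd d),
      mOp ε lam A (kerSymb ε lam A (⇑K)) (⇑φ) x = ∫ y : Vd d, K (x, y) * φ y := by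
  refine ⟨⟨partialFourierSchwartz (wignerKernel hε.ne' lam A K), fun X ↦ ?_⟩,
    fun φ x ↦ mOp_kerSymb hε.ne' lam hA K φ x⟩
  rw [kerSymb_eq_partialFourier hε.ne' lam hA, partialFourierSchwartz_apply]
end
end

section
/- Let d ≥ 1, λ ∈ ℝ, and let B : ℝ^d → ℝ^{d×d} be antisymmetric with all components smooth, bounded and with bounded derivatives of all orders. Fix f, g ∈ S(ℝ^{2d}) and X = (x,ξ) ∈ ℝ^{2d}, and let P(ε) := (f ⋆^B_{ε,λ} g)(X), defined for all ε ∈ ℝ. Then P is differentiable at ε = 0 with P(0) = f(X)g(X) and P'(0) = −(i/2) Σ_{l=1}^d ( ∂_{ξ_l}f(X) ∂_{x_l}g(X) − ∂_{x_l}f(X) ∂_{ξ_l}g(X) ) + (iλ/2) Σ_{l,j=1}^d B_{lj}(x) ∂_{ξ_l}f(X) ∂_{ξ_j}g(X). (These are the first-order terms (f ⋆ g)_{(1,0)} and (f ⋆ g)_{(1,1)} of the two-parameter asymptotic expansion of the magnetic Weyl product.) -/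
noncomputable section
open MeasureTheory Complex

/-- The symplectic form `σ((x,ξ),(y,η)) = ξ·y - x·η`. -/
def symp {d : ℕ} (X Y : Vd d × Vd d) : ℝ := dotR X.2 Y.1 - dotR X.1 Y.2

/-- The symplectic Fourier transform `(F_σ f)(Y) = (2π)^{-d} ∫ e^{iσ(Y,X)} f(X) dX`. -/
def symFT {d : ℕ} (f : Vd d × Vd d → ℂ) (Y : Vd d × Vd d) : ℂ :=
  (((2 * Real.pi) ^ d)⁻¹ : ℝ) *
    ∫ X : Vd d × Vd d, Complex.exp (Complex.I * symp Y X) * f X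

/-- `B̃^ε_{lj}(x,y,z) := (1/2)∫_{-1/2}^{1/2}dt ∫_0^1 ds s [B_{lj}(x+εs(ty-z/2)) + B_{lj}(x+εs(y/2+tz))]`. -/
def Btil {d : ℕ} (ε : ℝ) (B : Vd d → Fin d → Fin d → ℝ) (x y z : Vd d)
    (l j : Fin d) : ℝ :=
  (2:ℝ)⁻¹ * ∫ t in (-(2:ℝ)⁻¹)..(2:ℝ)⁻¹, ∫ s in (0:ℝ)..1,
    s * (B (x + (ε * s) • (t • y - (2:ℝ)⁻¹ • z)) l j
          + B (x + (ε * s) • ((2:ℝ)⁻¹ • y + t • z)) l j)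

/-- The scaled magnetic flux `γ^B_ε(x,y,z) := ε Σ_{l,j} B̃^ε_{lj}(x,y,z) y_l z_j`. -/
def gammaB {d : ℕ} (ε : ℝ) (B : Vd d → Fin d → Fin d → ℝ) (x y z : Vd d) : ℝ :=
  ε * ∑ l, ∑ j, Btil ε B x y z l j * y l * z j

/-- The magnetic Moyal product
`(f ⋆^B_{ε,λ} g)(X) = (2π)^{-2d} ∫∫ e^{iσ(X,Y+Z)} e^{i(ε/2)σ(Y,Z) - iλγ^B_ε(x,y,z)} (F_σf)(Y) (F_σg)(Z) dY dZ`. -/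
def moyalB {d : ℕ} (ε lam : ℝ) (B : Vd d → Fin d → Fin d → ℝ)
    (f g : Vd d × Vd d → ℂ) (X : Vd d × Vd d) : ℂ :=
  (((2 * Real.pi) ^ (2 * d))⁻¹ : ℝ) * ∫ Y : Vd d × Vd d, ∫ Z : Vd d × Vd d,
    Complex.exp (Complex.I * symp X (Y + Z)) *
      Complex.exp (Complex.I * (ε / 2) * symp Y Z
        - Complex.I * lam * gammaB ε B X.1 Y.1 Z.1) *
      symFT f Y * symFT g Z

section Symp

variable {d : ℕ}

lemma dotR_add_right (x y z : Vd d) : dotR x (y + z) = dotR x y + dotR x z := by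
  simp [dotR, mul_add, Finset.sum_add_distrib]

lemma symp_add_right (X Y Z : Vd d × Vd d) : symp X (Y + Z) = symp X Y + symp X Z := by
  simp only [symp, Prod.fst_add, Prod.snd_add, dotR_add_right]
  ring

lemma symp_add_smul_left (X v Y : Vd d × Vd d) (t : ℝ) :
    symp (X + t • v) Y = symp X Y + t * symp v Y := by
  simp only [symp, dotR, Prod.fst_add, Prod.snd_add, Prod.smul_fst, Prod.smul_snd, Pi.add_apply,
    Pi.smul_apply, smul_eq_mul, add_mul, mul_assoc, Finset.sum_add_distrib, ← Finset.mul_sum]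
  ring

lemma symp_zero_single (l : Fin d) (Y : Vd d × Vd d) :
    symp ((0 : Vd d), Pi.single l 1) Y = Y.1 l := by
  simp [symp, dotR, Pi.single_apply]

lemma symp_single_zero (l : Fin d) (Y : Vd d × Vd d) :
    symp (Pi.single l 1, (0 : Vd d)) Y = -Y.2 l := by
  simp [symp, dotR, Pi.single_apply]

@[fun_prop]
lemma continuous_symp : Continuous fun p : (Vd d × Vd d) × (Vd d × Vd d) => symp p.1 p.2 := by
  unfold symp dotR
  fun_prop

lemma abs_dotR_le (x y : Vd d) : |dotR x y| ≤ d * (‖x‖ * ‖y‖) := by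
  calc |dotR x y| ≤ ∑ l, |x l * y l| := Finset.abs_sum_le_sum_abs _ _
    _ ≤ ∑ _l : Fin d, ‖x‖ * ‖y‖ := by
        refine Finset.sum_le_sum fun l _ => ?_
        rw [abs_mul]
        exact mul_le_mul (norm_le_pi_norm x l) (norm_le_pi_norm y l) (abs_nonneg _) (norm_nonneg _)
    _ = d * (‖x‖ * ‖y‖) := by simp

lemma abs_symp_le (X Y : Vd d × Vd d) : |symp X Y| ≤ 2 * d * (‖X‖ * ‖Y‖) := by
  have h1 : ‖X.2‖ * ‖Y.1‖ ≤ ‖X‖ * ‖Y‖ := by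
    gcongr
    exacts [norm_snd_le X, norm_fst_le Y]
  have h2 : ‖X.1‖ * ‖Y.2‖ ≤ ‖X‖ * ‖Y‖ := by
    gcongr
    exacts [norm_fst_le X, norm_snd_le Y]
  have hd : (0 : ℝ) ≤ d := d.cast_nonneg
  calc |symp X Y| ≤ |dotR X.2 Y.1| + |dotR X.1 Y.2| := abs_sub _ _
    _ ≤ d * (‖X.2‖ * ‖Y.1‖) + d * (‖X.1‖ * ‖Y.2‖) :=
        add_le_add (abs_dotR_le _ _) (abs_dotR_le _ _)
    _ ≤ d * (‖X‖ * ‖Y‖) + d * (‖X‖ * ‖Y‖) := by gcongr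
    _ = 2 * d * (‖X‖ * ‖Y‖) := by ring

end Symp

section Inversion

open FourierTransform

variable {d : ℕ}

instance isAddHaarMeasure_volume_phase :
    (volume : Measure (Vd d × Vd d)).IsAddHaarMeasure :=
  Measure.prod.instIsAddHaarMeasure volume volume

/-- Phase space with its Euclidean structure. -/
abbrev EuclideanPhase (d : ℕ) :=
  WithLp 2 (EuclideanSpace ℝ (Fin d) × EuclideanSpace ℝ (Fin d))

/-- The identification of Euclidean phase space with `ℝ^d × ℝ^d`. -/
def phaseEquiv (d : ℕ) : EuclideanPhase d ≃L[ℝ] Vd d × Vd d :=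
  (WithLp.prodContinuousLinearEquiv 2 ℝ _ _).trans
    ((EuclideanSpace.equiv (Fin d) ℝ).prodCongr (EuclideanSpace.equiv (Fin d) ℝ))

lemma measurePreserving_phaseEquiv : MeasurePreserving (phaseEquiv d) :=
  ((PiLp.volume_preserving_ofLp (Fin d)).prod (PiLp.volume_preserving_ofLp (Fin d))).comp
    (WithLp.volume_preserving_ofLp _ _)

/-- The rotation `(y, η) ↦ (-η, y)`, which turns the symplectic form into the inner product. -/
def phaseRot (d : ℕ) : (Vd d × Vd d) ≃L[ℝ] Vd d × Vd d :=
  (ContinuousLinearEquiv.prodComm ℝ (Vd d) (Vd d)).trans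
    ((ContinuousLinearEquiv.neg ℝ).prodCongr (ContinuousLinearEquiv.refl ℝ _))

lemma measurePreserving_phaseRot : MeasurePreserving (phaseRot d) :=
  ((Measure.measurePreserving_neg (volume : Measure (Vd d))).prod (MeasurePreserving.id _)).comp
    Measure.measurePreserving_swap

/-- The linear substitution relating the symplectic and the Euclidean Fourier transforms. -/
def phaseSubst (d : ℕ) : (Vd d × Vd d) ≃L[ℝ] EuclideanPhase d :=
  ((phaseRot d).trans (ContinuousLinearEquiv.smulLeft
    (Units.mk0 (2 * Real.pi)⁻¹ (by positivity)))).trans (phaseEquiv d).symm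

lemma integral_comp_phaseSubst (h : EuclideanPhase d → ℂ) :
    ∫ Y, h (phaseSubst d Y) = ((2 * Real.pi) ^ (2 * d) : ℝ) * ∫ v, h v := by
  have h1 : ∫ Y, h (phaseSubst d Y)
      = ∫ Y, h ((phaseEquiv d).symm ((2 * Real.pi)⁻¹ • phaseRot d Y)) := rfl
  rw [h1, measurePreserving_phaseRot.integral_comp
      (phaseRot d).toHomeomorph.measurableEmbedding
      (fun Y => h ((phaseEquiv d).symm ((2 * Real.pi)⁻¹ • Y))),
    Measure.integral_comp_smul volume (fun Y => h ((phaseEquiv d).symm Y)),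
    ← measurePreserving_phaseEquiv.integral_comp
      (phaseEquiv d).toHomeomorph.measurableEmbedding]
  have : Module.finrank ℝ (Vd d × Vd d) = 2 * d := by simp; ring
  rw [this, Complex.real_smul]
  simp only [ContinuousLinearEquiv.symm_apply_apply, inv_pow, inv_inv]
  rw [abs_of_nonneg (by positivity)]

lemma two_pi_inner_phaseSubst (Y : Vd d × Vd d) (v : EuclideanPhase d) :
    2 * Real.pi * inner ℝ v (phaseSubst d Y) = -symp Y (phaseEquiv d v) := by
  have h1 : (phaseSubst d Y).ofLp.1 = WithLp.toLp 2 ((2 * Real.pi)⁻¹ • (-Y.2)) := rfl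
  have h2 : (phaseSubst d Y).ofLp.2 = WithLp.toLp 2 ((2 * Real.pi)⁻¹ • Y.1) := rfl
  have h3 : (phaseEquiv d v).1 = v.ofLp.1.ofLp := rfl
  have h4 : (phaseEquiv d v).2 = v.ofLp.2.ofLp := rfl
  rw [WithLp.prod_inner_apply, h1, h2, symp, h3, h4, dotR, dotR]
  simp only [PiLp.inner_apply]
  simp only [Pi.smul_apply, Pi.neg_apply, smul_eq_mul, RCLike.inner_apply, conj_trivial,
    mul_add, Finset.mul_sum, ← Finset.sum_add_distrib, ← Finset.sum_sub_distrib,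
    ← Finset.sum_neg_distrib]
  refine Finset.sum_congr rfl fun l _ => ?_
  field_simp
  ring

/-- The symplectic Fourier transform of a Schwartz function is a Schwartz function, and the
transform is inverted by the same formula. -/
lemma exists_schwartz_symFT (f : SchwartzMap (Vd d × Vd d) ℂ) :
    ∃ F : SchwartzMap (Vd d × Vd d) ℂ, symFT f = F ∧
      ∀ X, f X = (((2 * Real.pi) ^ d)⁻¹ : ℝ) * ∫ Y, exp (I * symp X Y) * F Y := by
  let fe : SchwartzMap (EuclideanPhase d) ℂ :=
    SchwartzMap.compCLMOfContinuousLinearEquiv ℂ (phaseEquiv d) f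
  let F : SchwartzMap (Vd d × Vd d) ℂ := (((2 * Real.pi) ^ d)⁻¹ : ℝ) •
    SchwartzMap.compCLMOfContinuousLinearEquiv ℂ (phaseSubst d) (𝓕 fe)
  have hF : ∀ Y, F Y = (((2 * Real.pi) ^ d)⁻¹ : ℝ) * 𝓕 (fe : EuclideanPhase d → ℂ)
      (phaseSubst d Y) := fun Y => Complex.real_smul
  refine ⟨F, ?_, fun X => ?_⟩
  · funext Y
    rw [hF, symFT, Real.fourier_eq', ← measurePreserving_phaseEquiv.integral_comp
      (phaseEquiv d).toHomeomorph.measurableEmbedding]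
    congr 1
    refine integral_congr_ae (Filter.Eventually.of_forall fun v => ?_)
    have h := two_pi_inner_phaseSubst Y v
    have h' : -2 * Real.pi * inner ℝ v (phaseSubst d Y) = symp Y (phaseEquiv d v) := by linarith
    simp only [h', smul_eq_mul, mul_comm I]
    rfl
  · let k : EuclideanPhase d → ℂ := fun w =>
      exp (((2 * Real.pi * inner ℝ w ((phaseEquiv d).symm X) : ℝ) : ℂ) * I) •
        𝓕 (fe : EuclideanPhase d → ℂ) w
    have h1 : ∀ Y, exp (I * symp X Y) * F Y =
        (((2 * Real.pi) ^ d)⁻¹ : ℝ) * k (phaseSubst d Y) := by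
      intro Y
      have h := two_pi_inner_phaseSubst Y ((phaseEquiv d).symm X)
      rw [real_inner_comm, ContinuousLinearEquiv.apply_symm_apply] at h
      have hs : -symp Y X = symp X Y := by
        simp only [symp, dotR, mul_comm]
        ring
      simp only [k, h, hs, hF, smul_eq_mul, mul_comm I]
      ring
    simp_rw [h1]
    rw [integral_const_mul, integral_comp_phaseSubst k, ← Real.fourierInv_eq']
    have h2 : 𝓕⁻ (𝓕 (fe : EuclideanPhase d → ℂ)) = fe := by
      rw [← SchwartzMap.fourier_coe, ← SchwartzMap.fourierInv_coe,
        FourierTransform.fourierInv_fourier_eq]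
    rw [h2]
    have h3 : fe ((phaseEquiv d).symm X) = f X := by simp [fe]
    rw [h3]
    have : ((2 * Real.pi : ℝ) : ℂ) ≠ 0 := by
      exact_mod_cast (by positivity : (2 * Real.pi : ℝ) ≠ 0)
    push_cast at this ⊢
    field_simp
    rw [mul_comm 2 d, pow_mul]

end Inversion

lemma norm_exp_I_mul_sub_exp_I_mul_le (a b : ℝ) :
    ‖exp (I * a) - exp (I * b)‖ ≤ |a - b| := by
  have h : exp (I * a) - exp (I * b) = exp (I * b) * (exp (I * ((a - b : ℝ) : ℂ)) - 1) := by
    rw [mul_sub, mul_one, ← exp_add]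
    push_cast
    ring_nf
  rw [h, norm_mul, norm_exp_I_mul_ofReal, one_mul]
  exact Real.norm_exp_I_mul_ofReal_sub_one_le

/-- Differentiation under the integral sign for an oscillatory integral. -/
lemma hasDerivAt_integral_exp_phase {α : Type*} [MeasurableSpace α] {μ : Measure α}
    {G : α → ℂ} {θ : ℝ → α → ℝ} {θ' b : α → ℝ} (hG : Integrable G μ)
    (hθ : ∀ t, AEStronglyMeasurable (θ t) μ) (hθ' : AEStronglyMeasurable θ' μ)
    (hb : Integrable (fun a => b a * ‖G a‖) μ) (hlip : ∀ t a, |θ t a - θ 0 a| ≤ b a * |t|)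
    (hder : ∀ a, HasDerivAt (θ · a) (θ' a) 0) :
    HasDerivAt (fun t => ∫ a, exp (I * θ t a) * G a ∂μ)
      (∫ a, exp (I * θ 0 a) * (I * θ' a) * G a ∂μ) 0 := by
  have hexp : ∀ t, AEStronglyMeasurable (fun a => exp (I * θ t a)) μ := fun t =>
    (by fun_prop : Continuous fun r : ℝ => exp (I * r)).comp_aestronglyMeasurable (hθ t)
  have hF' : AEStronglyMeasurable (fun a => exp (I * θ 0 a) * (I * θ' a) * G a) μ :=
    ((hexp 0).mul ((by fun_prop : Continuous fun r : ℝ => I * (r : ℂ)).comp_aestronglyMeasurable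
      hθ')).mul hG.1
  let L := ContinuousLinearMap.smulRightL ℝ ℝ ℂ 1
  have key := hasFDerivAt_integral_of_dominated_loc_of_lip' (𝕜 := ℝ) (μ := μ) (x₀ := (0 : ℝ))
    (F := fun t a => exp (I * θ t a) * G a) (bound := fun a => b a * ‖G a‖)
    (F' := fun a => L (exp (I * θ 0 a) * (I * θ' a) * G a)) Filter.univ_mem
    (fun t _ => (hexp t).mul hG.1)
    (hG.bdd_mul (c := 1) (hexp 0) (Filter.Eventually.of_forall fun a =>
      (norm_exp_I_mul_ofReal _).le))
    (L.continuous.comp_aestronglyMeasurable hF')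
    (Filter.Eventually.of_forall fun a t _ => ?_) hb
    (Filter.Eventually.of_forall fun a => ?_)
  · have h := key.2.hasDerivAt
    rw [ContinuousLinearMap.integral_apply key.1] at h
    simpa [L] using h
  · rw [← sub_mul, norm_mul]
    calc ‖exp (I * θ t a) - exp (I * θ 0 a)‖ * ‖G a‖ ≤ (b a * |t|) * ‖G a‖ := by
          gcongr
          exact (norm_exp_I_mul_sub_exp_I_mul_le _ _).trans (hlip t a)
      _ = b a * ‖G a‖ * ‖t - 0‖ := by
          rw [sub_zero, Real.norm_eq_abs]
          ring
  · exact (((hder a).ofReal_comp.const_mul I).cexp.mul_const (G a)).hasFDerivAt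

section Schwartz

variable {d : ℕ}

lemma integrable_norm_mul_norm_schwartz (F : SchwartzMap (Vd d × Vd d) ℂ) :
    Integrable fun Y => ‖Y‖ * ‖F Y‖ := by
  simpa using F.integrable_pow_mul volume 1

lemma integrable_exp_symp_mul_schwartz (F : SchwartzMap (Vd d × Vd d) ℂ) (X : Vd d × Vd d)
    {u : Vd d × Vd d → ℝ} (hu : Continuous u) (hle : ∀ Y, |u Y| ≤ ‖Y‖) :
    Integrable fun Y => u Y * (exp (I * symp X Y) * F Y) := by
  have hc : Continuous fun Y => symp X Y := by fun_prop
  have hF := F.continuous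
  refine (integrable_norm_mul_norm_schwartz F).mono'
    (by fun_prop : Continuous _).aestronglyMeasurable (Filter.Eventually.of_forall fun Y => ?_)
  rw [norm_mul, norm_mul, norm_exp_I_mul_ofReal, one_mul, norm_real]
  gcongr
  exact hle Y

lemma fderiv_of_symFT_inversion {f : Vd d × Vd d → ℂ} {c : ℂ}
    {F : SchwartzMap (Vd d × Vd d) ℂ}
    (hf : ∀ X, f X = c * ∫ Y, exp (I * symp X Y) * F Y) {X : Vd d × Vd d}
    (hdf : DifferentiableAt ℝ f X) (v : Vd d × Vd d) :
    fderiv ℝ f X v = c * (I * ∫ Y, symp v Y * (exp (I * symp X Y) * F Y)) := by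
  have hline : HasDerivAt (fun t : ℝ => X + t • v) v 0 := by
    simpa using ((hasDerivAt_id (0 : ℝ)).smul_const v).const_add X
  have h1 : HasDerivAt (fun t : ℝ => f (X + t • v)) (fderiv ℝ f X v) 0 := by
    have : HasFDerivAt f (fderiv ℝ f X) (X + (0 : ℝ) • v) := by simpa using hdf.hasFDerivAt
    exact this.comp_hasDerivAt 0 hline
  have h2 := (hasDerivAt_integral_exp_phase (μ := volume) (G := F)
    (θ := fun t Y => symp (X + t • v) Y) (θ' := fun Y => symp v Y)
    (b := fun Y => 2 * d * (‖v‖ * ‖Y‖)) F.integrable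
    (fun t => (by fun_prop : Continuous fun Y => symp (X + t • v) Y).aestronglyMeasurable)
    (by fun_prop : Continuous fun Y => symp v Y).aestronglyMeasurable
    (by simpa [mul_assoc] using
      ((integrable_norm_mul_norm_schwartz F).const_mul ‖v‖).const_mul (2 * d : ℝ))
    (fun t Y => by
      simp only [symp_add_smul_left, zero_mul, add_zero, add_sub_cancel_left, abs_mul]
      rw [mul_comm]
      gcongr
      exact abs_symp_le v Y)
    (fun Y => by
      simp only [symp_add_smul_left]
      simpa using ((hasDerivAt_id (0 : ℝ)).mul_const (symp v Y)).const_add (symp X Y))).const_mul c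
  simp only [← hf] at h2
  rw [h1.unique h2, ← integral_const_mul I]
  congr 2
  funext Y
  simp only [zero_smul, add_zero]
  ring

end Schwartz

section Flux

variable {d : ℕ} {B : Vd d → Fin d → Fin d → ℝ}

lemma continuous_Btil (hB : ∀ l j, Continuous fun x => B x l j) (x : Vd d) (l j : Fin d) :
    Continuous fun p : ℝ × Vd d × Vd d => Btil p.1 B x p.2.1 p.2.2 l j := by
  unfold Btil
  refine continuous_const.mul ?_
  apply intervalIntegral.continuous_parametric_intervalIntegral_of_continuous'
  apply intervalIntegral.continuous_parametric_intervalIntegral_of_continuous'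
  have := hB l j
  refine continuous_snd.mul (Continuous.add ?_ ?_) <;>
  exact this.comp (by fun_prop)

lemma continuous_gammaB {α : Type*} [TopologicalSpace α]
    (hB : ∀ l j, Continuous fun x => B x l j) (ε : ℝ) (x : Vd d) {u v : α → Vd d}
    (hu : Continuous u) (hv : Continuous v) : Continuous fun a => gammaB ε B x (u a) (v a) := by
  have h : ∀ l j, Continuous fun a => Btil ε B x (u a) (v a) l j := fun l j =>
    (continuous_Btil hB x l j).comp (by fun_prop : Continuous fun a => (ε, u a, v a))
  unfold gammaB
  fun_prop

lemma Btil_zero (x y z : Vd d) (l j : Fin d) : Btil 0 B x y z l j = B x l j / 2 := by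
  simp only [Btil, zero_mul, zero_smul, add_zero, intervalIntegral.integral_mul_const,
    integral_id, intervalIntegral.integral_const, smul_eq_mul]
  ring

lemma abs_Btil_le {C : ℝ} {l j : Fin d} (hC : ∀ x, |B x l j| ≤ C) (ε : ℝ) (x y z : Vd d) :
    |Btil ε B x y z l j| ≤ C := by
  have h : ∀ t ∈ Set.uIoc (-(2:ℝ)⁻¹) (2:ℝ)⁻¹, ‖∫ s in (0:ℝ)..1,
      s * (B (x + (ε * s) • (t • y - (2:ℝ)⁻¹ • z)) l j
          + B (x + (ε * s) • ((2:ℝ)⁻¹ • y + t • z)) l j)‖ ≤ 2 * C := fun t _ => by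
    have := intervalIntegral.norm_integral_le_of_norm_le_const (a := (0 : ℝ)) (b := 1)
      (C := 2 * C) (f := fun s => s * (B (x + (ε * s) • (t • y - (2:ℝ)⁻¹ • z)) l j
          + B (x + (ε * s) • ((2:ℝ)⁻¹ • y + t • z)) l j)) fun s hs => by
        rw [Set.uIoc_of_le zero_le_one] at hs
        rw [norm_mul, Real.norm_eq_abs, abs_of_pos hs.1]
        have h1 := (abs_add_le (B (x + (ε * s) • (t • y - (2:ℝ)⁻¹ • z)) l j)
          (B (x + (ε * s) • ((2:ℝ)⁻¹ • y + t • z)) l j)).trans (add_le_add (hC _) (hC _))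
        rw [← two_mul] at h1
        exact (mul_le_of_le_one_left (norm_nonneg _) hs.2).trans h1
    simpa using this
  have := intervalIntegral.norm_integral_le_of_norm_le_const h
  rw [Btil, abs_mul, abs_of_pos (by norm_num : (0 : ℝ) < 2⁻¹)]
  norm_num at this ⊢
  linarith

lemma abs_gammaB_le {C : ℝ} (hC : ∀ x l j, |B x l j| ≤ C) (ε : ℝ) (x y z : Vd d) :
    |gammaB ε B x y z| ≤ d * d * C * (‖y‖ * ‖z‖) * |ε| := by
  rw [gammaB, abs_mul, mul_comm]
  gcongr
  calc |∑ l, ∑ j, Btil ε B x y z l j * y l * z j|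
      ≤ ∑ l, ∑ j, |Btil ε B x y z l j * y l * z j| :=
        (Finset.abs_sum_le_sum_abs _ _).trans
          (Finset.sum_le_sum fun l _ => Finset.abs_sum_le_sum_abs _ _)
    _ ≤ ∑ _l : Fin d, ∑ _j : Fin d, C * ‖y‖ * ‖z‖ := by
        refine Finset.sum_le_sum fun l _ => Finset.sum_le_sum fun j _ => ?_
        rw [abs_mul, abs_mul]
        have h0 : 0 ≤ C := (abs_nonneg _).trans (hC x l j)
        gcongr
        exacts [abs_Btil_le (fun x => hC x l j) ε x y z, norm_le_pi_norm y l, norm_le_pi_norm z j]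
    _ = d * d * C * (‖y‖ * ‖z‖) := by
        simp
        ring

lemma hasDerivAt_gammaB (hB : ∀ l j, Continuous fun x => B x l j) (x y z : Vd d) :
    HasDerivAt (fun ε => gammaB ε B x y z) (∑ l, ∑ j, B x l j / 2 * y l * z j) 0 := by
  have hc : Continuous fun ε => ∑ l, ∑ j, Btil ε B x y z l j * y l * z j := by
    have h : ∀ l j, Continuous fun ε => Btil ε B x y z l j := fun l j =>
      (continuous_Btil hB x l j).comp (by fun_prop : Continuous fun ε : ℝ => (ε, y, z))
    fun_prop
  rw [hasDerivAt_iff_tendsto_slope]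
  have h0 := (hc.tendsto 0).mono_left (nhdsWithin_le_nhds (s := {0}ᶜ))
  simp only [Btil_zero] at h0
  refine h0.congr' ?_
  filter_upwards [self_mem_nhdsWithin] with ε hε
  have hε' : ε ≠ 0 := hε
  simp [slope_def_field, gammaB, hε']

end Flux

section Moyal

variable {d : ℕ} {B : Vd d → Fin d → Fin d → ℝ}

/-- The total phase of the magnetic Moyal product at `X`. -/
def moyalPhase (lam : ℝ) (B : Vd d → Fin d → Fin d → ℝ) (X : Vd d × Vd d) (ε : ℝ)
    (p : (Vd d × Vd d) × (Vd d × Vd d)) : ℝ :=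
  symp X (p.1 + p.2) + (ε / 2 * symp p.1 p.2 - lam * gammaB ε B X.1 p.1.1 p.2.1)

/-- The derivative of `moyalPhase` at `ε = 0`. -/
def moyalPhaseDeriv (lam : ℝ) (B : Vd d → Fin d → Fin d → ℝ) (X : Vd d × Vd d)
    (p : (Vd d × Vd d) × (Vd d × Vd d)) : ℝ :=
  1 / 2 * symp p.1 p.2 - lam * ∑ l, ∑ j, B X.1 l j / 2 * p.1.1 l * p.2.1 j

lemma continuous_moyalPhase (hB : ∀ l j, Continuous fun x => B x l j) (lam : ℝ)
    (X : Vd d × Vd d) (ε : ℝ) : Continuous (moyalPhase lam B X ε) := by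
  have h : Continuous fun p : (Vd d × Vd d) × (Vd d × Vd d) => gammaB ε B X.1 p.1.1 p.2.1 :=
    continuous_gammaB hB ε X.1 (by fun_prop) (by fun_prop)
  unfold moyalPhase
  fun_prop

lemma moyalB_eq_integral_prod (hB : ∀ l j, Continuous fun x => B x l j)
    {f g : Vd d × Vd d → ℂ} {F G : SchwartzMap (Vd d × Vd d) ℂ}
    (hF : symFT f = F) (hG : symFT g = G) (lam : ℝ) (X : Vd d × Vd d) (ε : ℝ) :
    moyalB ε lam B f g X = (((2 * Real.pi) ^ (2 * d))⁻¹ : ℝ) *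
      ∫ p : (Vd d × Vd d) × (Vd d × Vd d),
        exp (I * moyalPhase lam B X ε p) * (F p.1 * G p.2) := by
  have hint : Integrable (fun p : (Vd d × Vd d) × (Vd d × Vd d) =>
      exp (I * moyalPhase lam B X ε p) * (F p.1 * G p.2)) (volume.prod volume) := by
    have hc := continuous_moyalPhase hB lam X ε
    have hexp : Continuous fun p => exp (I * moyalPhase lam B X ε p) := by fun_prop
    exact (F.integrable.mul_prod G.integrable).bdd_mul (c := 1) hexp.aestronglyMeasurable
      (Filter.Eventually.of_forall fun p => (norm_exp_I_mul_ofReal _).le)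
  rw [Measure.volume_eq_prod (Vd d × Vd d) (Vd d × Vd d), integral_prod _ hint, moyalB, hF, hG]
  congr 1
  refine integral_congr_ae (Filter.Eventually.of_forall fun Y =>
    integral_congr_ae (Filter.Eventually.of_forall fun Z => ?_))
  simp only [moyalPhase]
  rw [← exp_add, mul_assoc]
  push_cast
  ring_nf

lemma hasDerivAt_integral_moyalPhase (hB : ∀ l j, Continuous fun x => B x l j) {C : ℝ}
    (hC : ∀ x l j, |B x l j| ≤ C) (lam : ℝ) (F G : SchwartzMap (Vd d × Vd d) ℂ)
    (X : Vd d × Vd d) :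
    HasDerivAt (fun ε => ∫ p : (Vd d × Vd d) × (Vd d × Vd d),
        exp (I * moyalPhase lam B X ε p) * (F p.1 * G p.2))
      (∫ p : (Vd d × Vd d) × (Vd d × Vd d), exp (I * moyalPhase lam B X 0 p) *
        (I * moyalPhaseDeriv lam B X p) * (F p.1 * G p.2)) 0 := by
  refine hasDerivAt_integral_exp_phase
    (b := fun p => (d + |lam| * (d * d * |C|)) * (‖p.1‖ * ‖p.2‖))
    (F.integrable.mul_prod G.integrable)
    (fun ε => (continuous_moyalPhase hB lam X ε).aestronglyMeasurable) ?_ ?_ (fun ε p => ?_)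
    (fun p => ?_)
  · unfold moyalPhaseDeriv
    exact (by fun_prop : Continuous _).aestronglyMeasurable
  · have := ((integrable_norm_mul_norm_schwartz F).mul_prod
      (integrable_norm_mul_norm_schwartz G)).const_mul (d + |lam| * (d * d * |C|))
    refine this.congr (Filter.Eventually.of_forall fun p => ?_)
    simp only [norm_mul]
    ring
  · have hγ := abs_gammaB_le hC ε X.1 p.1.1 p.2.1
    have h1 : ‖p.1.1‖ * ‖p.2.1‖ ≤ ‖p.1‖ * ‖p.2‖ := by
      gcongr
      exacts [norm_fst_le p.1, norm_fst_le p.2]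
    have h2 : |gammaB ε B X.1 p.1.1 p.2.1| ≤ d * d * |C| * (‖p.1‖ * ‖p.2‖) * |ε| := by
      refine hγ.trans ?_
      gcongr
      exact le_abs_self C
    have h3 : moyalPhase lam B X ε p - moyalPhase lam B X 0 p =
        ε / 2 * symp p.1 p.2 - lam * gammaB ε B X.1 p.1.1 p.2.1 := by
      simp [moyalPhase, gammaB]
    rw [h3]
    calc |ε / 2 * symp p.1 p.2 - lam * gammaB ε B X.1 p.1.1 p.2.1|
        ≤ |ε / 2 * symp p.1 p.2| + |lam * gammaB ε B X.1 p.1.1 p.2.1| := abs_sub _ _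
      _ ≤ |ε| / 2 * (2 * d * (‖p.1‖ * ‖p.2‖)) +
          |lam| * (d * d * |C| * (‖p.1‖ * ‖p.2‖) * |ε|) := by
          rw [abs_mul, abs_mul, abs_div, abs_two]
          gcongr
          exact abs_symp_le _ _
      _ = (d + |lam| * (d * d * |C|)) * (‖p.1‖ * ‖p.2‖) * |ε| := by ring
  · exact ((((hasDerivAt_id (0 : ℝ)).div_const 2).mul_const _).sub
      ((hasDerivAt_gammaB hB X.1 p.1.1 p.2.1).const_mul lam)).const_add _

lemma integral_bilinear_sum {ι α : Type*} [Fintype ι] [MeasurableSpace α] {μ : Measure α}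
    [SFinite μ] {a₁ a₂ b₁ b₂ : ι → α → ℂ} (ha₁ : ∀ l, Integrable (a₁ l) μ)
    (ha₂ : ∀ l, Integrable (a₂ l) μ) (hb₁ : ∀ l, Integrable (b₁ l) μ)
    (hb₂ : ∀ l, Integrable (b₂ l) μ) (k m : ℂ) (M : ι → ι → ℂ) :
    ∫ p : α × α, k * ∑ l, (a₂ l p.1 * b₁ l p.2 - a₁ l p.1 * b₂ l p.2) -
        m * ∑ l, ∑ j, M l j * (a₁ l p.1 * b₁ j p.2) ∂μ.prod μ =
      k * ∑ l, ((∫ y, a₂ l y ∂μ) * (∫ z, b₁ l z ∂μ) - (∫ y, a₁ l y ∂μ) * (∫ z, b₂ l z ∂μ)) -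
        m * ∑ l, ∑ j, M l j * ((∫ y, a₁ l y ∂μ) * (∫ z, b₁ j z ∂μ)) := by
  have hS : ∀ l, Integrable (fun p : α × α => a₂ l p.1 * b₁ l p.2 - a₁ l p.1 * b₂ l p.2)
      (μ.prod μ) := fun l => ((ha₂ l).mul_prod (hb₁ l)).sub ((ha₁ l).mul_prod (hb₂ l))
  have hM : ∀ l j, Integrable (fun p : α × α => M l j * (a₁ l p.1 * b₁ j p.2)) (μ.prod μ) :=
    fun l j => ((ha₁ l).mul_prod (hb₁ j)).const_mul _
  have hM' : ∀ l, Integrable (fun p : α × α => ∑ j, M l j * (a₁ l p.1 * b₁ j p.2))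
      (μ.prod μ) := fun l => integrable_finsetSum _ fun j _ => hM l j
  rw [integral_sub ((integrable_finsetSum _ fun l _ => hS l).const_mul k)
      ((integrable_finsetSum _ fun l _ => hM' l).const_mul m),
    integral_const_mul, integral_const_mul, integral_finsetSum _ fun l _ => hS l,
    integral_finsetSum _ fun l _ => hM' l]
  congr 2
  · refine Finset.sum_congr rfl fun l _ => ?_
    rw [integral_sub ((ha₂ l).mul_prod (hb₁ l)) ((ha₁ l).mul_prod (hb₂ l)),
      integral_prod_mul, integral_prod_mul]
  · refine Finset.sum_congr rfl fun l _ => ?_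
    rw [integral_finsetSum _ fun j _ => hM l j]
    refine Finset.sum_congr rfl fun j _ => ?_
    rw [integral_const_mul, integral_prod_mul]

lemma integral_moyalPhase_deriv (lam : ℝ) (F G : SchwartzMap (Vd d × Vd d) ℂ)
    (X : Vd d × Vd d) :
    ∫ p : (Vd d × Vd d) × (Vd d × Vd d), exp (I * symp X p.1) * exp (I * symp X p.2) *
        (I * moyalPhaseDeriv lam B X p) * (F p.1 * G p.2) =
      I / 2 * ∑ l, ((∫ Y, Y.2 l * (exp (I * symp X Y) * F Y)) *
            (∫ Z, Z.1 l * (exp (I * symp X Z) * G Z)) -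
          (∫ Y, Y.1 l * (exp (I * symp X Y) * F Y)) *
            (∫ Z, Z.2 l * (exp (I * symp X Z) * G Z))) -
        I * lam / 2 * ∑ l, ∑ j, B X.1 l j *
          ((∫ Y, Y.1 l * (exp (I * symp X Y) * F Y)) *
            (∫ Z, Z.1 j * (exp (I * symp X Z) * G Z))) := by
  have hi1 : ∀ (H : SchwartzMap (Vd d × Vd d) ℂ) (l : Fin d),
      Integrable fun Y : Vd d × Vd d => Y.1 l * (exp (I * symp X Y) * H Y) := fun H l =>
    integrable_exp_symp_mul_schwartz H X (by fun_prop)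
      fun Y => (norm_le_pi_norm Y.1 l).trans (norm_fst_le Y)
  have hi2 : ∀ (H : SchwartzMap (Vd d × Vd d) ℂ) (l : Fin d),
      Integrable fun Y : Vd d × Vd d => Y.2 l * (exp (I * symp X Y) * H Y) := fun H l =>
    integrable_exp_symp_mul_schwartz H X (by fun_prop)
      fun Y => (norm_le_pi_norm Y.2 l).trans (norm_snd_le Y)
  have hexpand : ∀ p : (Vd d × Vd d) × (Vd d × Vd d),
      exp (I * symp X p.1) * exp (I * symp X p.2) *
        (I * moyalPhaseDeriv lam B X p) * (F p.1 * G p.2) =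
      I / 2 * ∑ l, ((p.1.2 l * (exp (I * symp X p.1) * F p.1)) *
            (p.2.1 l * (exp (I * symp X p.2) * G p.2)) -
          (p.1.1 l * (exp (I * symp X p.1) * F p.1)) *
            (p.2.2 l * (exp (I * symp X p.2) * G p.2))) -
        I * lam / 2 * ∑ l, ∑ j, B X.1 l j *
          ((p.1.1 l * (exp (I * symp X p.1) * F p.1)) *
            (p.2.1 j * (exp (I * symp X p.2) * G p.2))) := by
    intro p
    simp only [moyalPhaseDeriv, symp, dotR, ← Finset.sum_sub_distrib]
    push_cast
    simp only [mul_sub, sub_mul, Finset.mul_sum, Finset.sum_mul, ← Finset.sum_sub_distrib]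
    refine Finset.sum_congr rfl fun l _ => ?_
    congr 1
    · ring
    · exact Finset.sum_congr rfl fun j _ => by ring
  simp_rw [hexpand]
  exact integral_bilinear_sum (hi1 F) (hi2 F) (hi1 G) (hi2 G) _ _ _

end Moyal

/-- First-order term of the two-parameter expansion of the magnetic Weyl product:
`P(ε) := (f ⋆^B_{ε,λ} g)(X)` satisfies `P(0) = f(X)g(X)` and
`P'(0) = -(i/2){f,g}(X) + (iλ/2) Σ_{l,j} B_{lj}(x) ∂_{ξ_l}f(X) ∂_{ξ_j}g(X)`. -/
theorem statement9 (d : ℕ) (hd : 1 ≤ d) (lam : ℝ)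
    (B : Vd d → Fin d → Fin d → ℝ)
    (hBanti : ∀ (x : Vd d) (l j : Fin d), B x l j = -B x j l)
    (hBsmooth : ∀ l j, ContDiff ℝ (⊤ : ℕ∞) fun x => B x l j)
    (hBbdd : ∀ (n : ℕ) (l j : Fin d), ∃ C, ∀ x,
      ‖iteratedFDeriv ℝ n (fun x => B x l j) x‖ ≤ C)
    (f g : SchwartzMap (Vd d × Vd d) ℂ) (X : Vd d × Vd d) :
    moyalB 0 lam B (⇑f) (⇑g) X = f X * g X ∧
    HasDerivAt (fun ε : ℝ => moyalB ε lam B (⇑f) (⇑g) X)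
      (-(Complex.I / 2) *
          (∑ l, (fderiv ℝ (⇑f) X ((0 : Vd d), Pi.single l 1)
                  * fderiv ℝ (⇑g) X (Pi.single l 1, (0 : Vd d))
                - fderiv ℝ (⇑f) X (Pi.single l 1, (0 : Vd d))
                  * fderiv ℝ (⇑g) X ((0 : Vd d), Pi.single l 1)))
        + (Complex.I * lam / 2) *
          (∑ l, ∑ j, B X.1 l j *
            (fderiv ℝ (⇑f) X ((0 : Vd d), Pi.single l 1)
              * fderiv ℝ (⇑g) X ((0 : Vd d), Pi.single j 1))))
      0 := by
  have hBc : ∀ l j, Continuous fun x => B x l j := fun l j => (hBsmooth l j).continuous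
  obtain ⟨C, hC⟩ : ∃ C, ∀ x l j, |B x l j| ≤ C := by
    choose C hC using hBbdd 0
    have hC' : ∀ x l j, |B x l j| ≤ C l j := fun x l j => by
      simpa using hC l j x
    have h0 : ∀ l j, 0 ≤ C l j := fun l j => (abs_nonneg _).trans (hC' 0 l j)
    refine ⟨∑ l, ∑ j, C l j, fun x l j => (hC' x l j).trans ?_⟩
    exact (Finset.single_le_sum (fun j _ => h0 l j) (Finset.mem_univ j)).trans
      (Finset.single_le_sum (f := fun l => ∑ j, C l j)
        (fun l _ => Finset.sum_nonneg fun j _ => h0 l j) (Finset.mem_univ l))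
  obtain ⟨F, hF, hfF⟩ := exists_schwartz_symFT f
  obtain ⟨G, hG, hgG⟩ := exists_schwartz_symFT g
  have hP : ∀ ε, moyalB ε lam B f g X = (((2 * Real.pi) ^ d)⁻¹ : ℝ) * (((2 * Real.pi) ^ d)⁻¹ : ℝ) *
      ∫ p : (Vd d × Vd d) × (Vd d × Vd d), exp (I * moyalPhase lam B X ε p) * (F p.1 * G p.2) := by
    intro ε
    rw [moyalB_eq_integral_prod hBc hF hG]
    congr 1
    rw [← ofReal_mul, ← mul_inv, ← pow_add, ← two_mul]
  have h0 : ∀ p : (Vd d × Vd d) × (Vd d × Vd d),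
      exp (I * moyalPhase lam B X 0 p) = exp (I * symp X p.1) * exp (I * symp X p.2) := by
    intro p
    rw [← exp_add, ← mul_add, moyalPhase, symp_add_right]
    simp [gammaB]
  refine ⟨?_, ?_⟩
  · rw [hP, hfF, hgG]
    have h1 : ∀ p : (Vd d × Vd d) × (Vd d × Vd d),
        exp (I * moyalPhase lam B X 0 p) * (F p.1 * G p.2) =
          (exp (I * symp X p.1) * F p.1) * (exp (I * symp X p.2) * G p.2) := fun p => by
      rw [h0, mul_mul_mul_comm]
    simp_rw [h1]
    rw [Measure.volume_eq_prod, integral_prod_mul (fun Y => exp (I * symp X Y) * F Y)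
      (fun Z => exp (I * symp X Z) * G Z)]
    ring
  · have key := (hasDerivAt_integral_moyalPhase hBc hC lam F G X).const_mul
      ((((2 * Real.pi) ^ d)⁻¹ : ℝ) * (((2 * Real.pi) ^ d)⁻¹ : ℝ) : ℂ)
    simp only [← hP] at key
    refine key.congr_deriv ?_
    have hf' := fderiv_of_symFT_inversion hfF (f.differentiableAt (x := X))
    have hg' := fderiv_of_symFT_inversion hgG (g.differentiableAt (x := X))
    simp only [hf', hg', symp_zero_single, symp_single_zero, h0, integral_moyalPhase_deriv]
    have hI : ∀ c x y : ℂ, c * (I * x) * (c * (I * y)) = -(c * c * (x * y)) := fun c x y => by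
      linear_combination c * c * x * y * I_mul_I
    simp only [ofReal_neg, neg_mul, integral_neg, mul_sub, mul_neg, hI, Finset.mul_sum,
      ← Finset.sum_sub_distrib, ← Finset.sum_add_distrib]
    refine Finset.sum_congr rfl fun l _ => ?_
    rw [sub_eq_add_neg, ← Finset.sum_neg_distrib]
    congr 1
    · ring
    · exact Finset.sum_congr rfl fun j _ => by ring
end
end
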